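/- For the stochastic saturation model, the second derivative of the negative log-likelihood loss is uniformly bounded away from zero on bounded parameter sets: let φ, Φ be the standard normal density and cdf, l < u real thresholds, θ ∈ ℝ, Z standard normal, s = θ + Z, δ = 1{s ≤ l}, δ̄ = 1{s ≥ u}, h(x) = (x φ(x) Φ(x) + φ(x)²)/Φ(x)², and g2 = δ · h(l − θ) + δ̄ · h(θ − u) + (1 − δ − δ̄). Then for every C > 0 there exists μ̲ > 0 (depending only on C, l, u) such that for all θ with |θ| ≤ C, almost surely μ̲ ≤ g2 ≤ 1. -/

import Mathlib

open MeasureTheory ProbabilityTheory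

noncomputable section

/-- The standard normal probability density `φ(x) = (1/√(2π)) e^{−x²/2}`. -/
def stdNormalPDF (x : ℝ) : ℝ :=
  (Real.sqrt (2 * Real.pi))⁻¹ * Real.exp (-x ^ 2 / 2)

/-- The standard normal cumulative distribution function `Φ(x) = ∫_{−∞}^x φ`. -/
def stdNormalCDF (x : ℝ) : ℝ := ∫ t in Set.Iio x, stdNormalPDF t

/-- The function `h(x) = (x φ(x) Φ(x) + φ(x)²) / Φ(x)²`. -/
def censoredHessian (x : ℝ) : ℝ :=
  (x * stdNormalPDF x * stdNormalCDF x + stdNormalPDF x ^ 2) / stdNormalCDF x ^ 2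

/-- The second derivative of the negative log-likelihood of the censored
Gaussian (saturation) model w.r.t. the linear predictor, at parameter `θ`,
when the latent variable is `s = θ + z`:
`g2 = δ·h(l−θ) + δ̄·h(θ−u) + (1−δ−δ̄)` with `δ = 1{s ≤ l}`, `δ̄ = 1{s ≥ u}`. -/
def saturationG2 (l u θ z : ℝ) : ℝ :=
  (if θ + z ≤ l then (1 : ℝ) else 0) * censoredHessian (l - θ) +
    (if u ≤ θ + z then (1 : ℝ) else 0) * censoredHessian (θ - u) +
    (1 - (if θ + z ≤ l then (1 : ℝ) else 0) - (if u ≤ θ + z then (1 : ℝ) else 0))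


lemma aux_pdf_pos (x : ℝ) : 0 < stdNormalPDF x := by
  unfold stdNormalPDF; positivity

lemma aux_cont : Continuous stdNormalPDF := by
  unfold stdNormalPDF; fun_prop

lemma aux_int (k : ℕ) : Integrable (fun t : ℝ => t ^ k * stdNormalPDF t) := by
  have h := (integrable_rpow_mul_exp_neg_mul_sq (b := 1 / 2) (by norm_num) (s := (k : ℝ))
    (by have : (0 : ℝ) ≤ k := Nat.cast_nonneg k
        linarith)).const_mul (Real.sqrt (2 * Real.pi))⁻¹
  refine h.congr (Filter.Eventually.of_forall fun t => ?_)
  simp only [stdNormalPDF, Real.rpow_natCast]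
  rw [show -(1 / 2) * t ^ 2 = -t ^ 2 / 2 by ring]
  ring

lemma aux_int0 : Integrable stdNormalPDF := by simpa using aux_int 0

lemma aux_int1 : Integrable (fun t : ℝ => t * stdNormalPDF t) := by simpa using aux_int 1

lemma aux_deriv (x : ℝ) : HasDerivAt stdNormalPDF (-x * stdNormalPDF x) x := by
  have h : HasDerivAt (fun x : ℝ => -x ^ 2 / 2) (-x) x := by
    have := ((hasDerivAt_id x).pow 2).neg.div_const 2
    exact this.congr_deriv (by simp; ring)
  have := h.exp.const_mul (Real.sqrt (2 * Real.pi))⁻¹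
  exact this.congr_deriv (by simp only [stdNormalPDF]; ring)

lemma aux_ftc (f f' : ℝ → ℝ) (hd : ∀ t, HasDerivAt f (f' t) t) (hf : Integrable f)
    (hf' : Integrable f') (x : ℝ) : ∫ t in Set.Iio x, f' t = f x := by
  have h0 := tendsto_zero_of_hasDerivAt_of_integrableOn_Iic (a := x) (fun t _ => hd t)
    hf'.integrableOn hf.integrableOn
  rw [← integral_Iic_eq_integral_Iio,
    integral_Iic_of_hasDerivAt_of_tendsto' (fun t _ => hd t) hf'.integrableOn h0, sub_zero]

lemma aux_cdf_pos (x : ℝ) : 0 < stdNormalCDF x := by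
  unfold stdNormalCDF
  rw [setIntegral_pos_iff_support_of_nonneg_ae
    (Filter.Eventually.of_forall fun t => (aux_pdf_pos t).le) aux_int0.integrableOn]
  have : Function.support stdNormalPDF = Set.univ := by
    ext t; simp [(aux_pdf_pos t).ne']
  simp [this]

lemma aux_num_pos (x : ℝ) : 0 < x * stdNormalCDF x + stdNormalPDF x := by
  have e : x * stdNormalCDF x + stdNormalPDF x
      = ∫ t in Set.Iio x, (x - t) * stdNormalPDF t := by
    have h1 := aux_ftc stdNormalPDF (fun t => -t * stdNormalPDF t) aux_deriv aux_int0
      (by simpa using aux_int1.neg) x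
    rw [← h1, stdNormalCDF, ← integral_const_mul, ← integral_add]
    · congr 1; ext t; ring
    · exact (aux_int0.const_mul x).integrableOn
    · have : Integrable (fun t => -t * stdNormalPDF t) := by simpa using aux_int1.neg
      exact this.integrableOn
  have hi : Integrable (fun t => (x - t) * stdNormalPDF t) := by
    convert (aux_int0.const_mul x).sub aux_int1 using 1
    ext t; simp; ring
  rw [e, setIntegral_pos_iff_support_of_nonneg_ae _ hi.integrableOn]
  · have : Function.support (fun t => (x - t) * stdNormalPDF t) ∩ Set.Iio x = Set.Iio x := by
      ext t
      simp only [Set.mem_inter_iff, Function.mem_support, Set.mem_Iio, and_iff_right_iff_imp]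
      intro ht
      exact (mul_pos (sub_pos.2 ht) (aux_pdf_pos t)).ne'
    rw [this]; simp
  · refine (ae_restrict_iff' measurableSet_Iio).2 (Filter.Eventually.of_forall fun t ht => ?_)
    exact (mul_pos (sub_pos.2 ht) (aux_pdf_pos t)).le

lemma aux_quad (c x : ℝ) :
    0 ≤ (c ^ 2 + 1) * stdNormalCDF x + (2 * c - x) * stdNormalPDF x := by
  have hi : Integrable (fun t => (t ^ 2 - 2 * c * t - 1) * stdNormalPDF t) := by
    convert ((aux_int 2).sub (aux_int1.const_mul (2 * c))).sub aux_int0 using 1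
    ext t; simp; ring
  have hi2 : Integrable (fun t => (2 * c - t) * stdNormalPDF t) := by
    convert (aux_int0.const_mul (2 * c)).sub aux_int1 using 1
    ext t; simp; ring
  have h1 := aux_ftc (fun t => (2 * c - t) * stdNormalPDF t) _ (fun t => by
    have := ((hasDerivAt_id t).const_sub (2 * c)).mul (aux_deriv t)
    have e : (t ^ 2 - 2 * c * t - 1) * stdNormalPDF t
      = -1 * stdNormalPDF t + (2 * c - id t) * (-t * stdNormalPDF t) := by simp; ring
    rw [← e] at this
    exact this) hi2 hi x
  rw [← h1, stdNormalCDF, ← integral_const_mul, ← integral_add]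
  · refine integral_nonneg fun t => ?_
    have : (c ^ 2 + 1) * stdNormalPDF t + (t ^ 2 - 2 * c * t - 1) * stdNormalPDF t
      = (c - t) ^ 2 * stdNormalPDF t := by ring
    simp only [Pi.zero_apply, this]
    exact mul_nonneg (sq_nonneg _) (aux_pdf_pos t).le
  · exact (aux_int0.const_mul _).integrableOn
  · exact hi.integrableOn

lemma aux_h_pos (x : ℝ) : 0 < censoredHessian x := by
  unfold censoredHessian
  have h1 := aux_pdf_pos x
  have h2 := aux_cdf_pos x
  have h3 := mul_pos h1 (aux_num_pos x)
  exact div_pos (by nlinarith) (by positivity)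

lemma aux_h_le (x : ℝ) : censoredHessian x ≤ 1 := by
  unfold censoredHessian
  have h2 := aux_cdf_pos x
  have h3 := mul_nonneg h2.le (aux_quad (-(stdNormalPDF x / stdNormalCDF x)) x)
  rw [div_le_one (by positivity)]
  have e : stdNormalCDF x * (((-(stdNormalPDF x / stdNormalCDF x)) ^ 2 + 1) * stdNormalCDF x +
      (2 * -(stdNormalPDF x / stdNormalCDF x) - x) * stdNormalPDF x)
      = stdNormalCDF x ^ 2 - stdNormalPDF x ^ 2 - x * stdNormalPDF x * stdNormalCDF x := by
    field_simp; ring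
  linarith

lemma aux_cdf_cont : Continuous stdNormalCDF := by
  have e : stdNormalCDF = fun x => (∫ t in (0 : ℝ)..x, stdNormalPDF t) + stdNormalCDF 0 := by
    ext x
    have := intervalIntegral.integral_Iic_sub_Iic (a := 0) (b := x)
      aux_int0.integrableOn aux_int0.integrableOn
    simp only [stdNormalCDF, ← integral_Iic_eq_integral_Iio]
    linarith
  rw [e]
  exact (intervalIntegral.continuous_primitive
    (fun a b => aux_int0.intervalIntegrable) 0).add continuous_const

lemma aux_h_cont : Continuous censoredHessian := by
  have h1 := aux_cont
  have h2 := aux_cdf_cont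
  unfold censoredHessian
  exact Continuous.div (by fun_prop) (by fun_prop) fun x => (pow_pos (aux_cdf_pos x) 2).ne'

lemma aux_h_lower (R : ℝ) (hR : 0 ≤ R) :
    ∃ m : ℝ, 0 < m ∧ ∀ x : ℝ, |x| ≤ R → m ≤ censoredHessian x := by
  obtain ⟨y, -, hy⟩ := (isCompact_Icc (a := -R) (b := R)).exists_isMinOn
    ⟨0, by simp [hR]⟩ aux_h_cont.continuousOn
  exact ⟨censoredHessian y, aux_h_pos y, fun x hx => hy (abs_le.1 hx)⟩

/-- **The saturation model satisfies Assumption 2(ii).** The second derivative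
`g2` of the negative log-likelihood loss is uniformly bounded away from zero on
bounded parameter sets: for every `C > 0` there exists `μ̲ > 0` (depending only
on `C`, `l`, `u`) such that for all `|θ| ≤ C`, almost surely
`μ̲ ≤ g2 ≤ 1` (w.r.t. the standard Gaussian law of `Z`). -/
theorem saturation_satisfies_assumption2ii (l u : ℝ) (hlu : l < u) :
    ∀ C : ℝ, 0 < C → ∃ μlo : ℝ, 0 < μlo ∧ ∀ θ : ℝ, |θ| ≤ C →
      ∀ᵐ z ∂(gaussianReal 0 1), μlo ≤ saturationG2 l u θ z ∧ saturationG2 l u θ z ≤ 1 := by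
  intro C hC
  obtain ⟨m, hm, hb⟩ := aux_h_lower (|l| + |u| + C) (by positivity)
  have hm1 : m ≤ 1 := (hb 0 (by simp; positivity)).trans (aux_h_le 0)
  refine ⟨m, hm, fun θ hθ => Filter.Eventually.of_forall fun z => ?_⟩
  have a1 : |l - θ| ≤ |l| + |u| + C := by
    have := abs_sub l θ
    have := abs_nonneg u
    linarith
  have a2 : |θ - u| ≤ |l| + |u| + C := by
    have := abs_sub θ u
    have := abs_nonneg l
    linarith
  have b1 := hb _ a1
  have b2 := hb _ a2
  have c1 := aux_h_le (l - θ)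
  have c2 := aux_h_le (θ - u)
  unfold saturationG2
  split_ifs with p q q
  · linarith
  · constructor <;> linarith
  · constructor <;> linarith
  · constructor <;> linarith

end
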